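/- Let K ⊆ ℝ² be a simple set with complementary domains W₁, W₂, let x ∈ K and ε > 0 with K \ closure(B(x,ε)) nonempty, and let β₀ : [0,1] → ℝ² be a cross-cut of W₁ whose end-points y₁ = β₀(0) and y₂ = β₀(1) are distinct points of the connected component K(closure(B(x,ε)), x) of x in K ∩ closure(B(x,ε)). Then the set K(closure(B(x,ε)), x) ∪ β₀([0,1]) is connected, and its complement in ℝ² has exactly two connected components V₁ and V₂; moreover β₀((0,1)) is contained in frontier V₁ ∩ frontier V₂, and after a suitable labeling V₁ ⊆ W₁ and W₂ ⊆ V₂. -/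

import Mathlib

open Set Metric Topology

noncomputable section

/-- The plane `ℝ²`. -/
abbrev Plane : Type := EuclideanSpace ℝ (Fin 2)

/-- `φ` is an end-cut of the open set `U` at the point `x`: an injective continuous map
`[0,1] → ℝ²` with `φ 0 = x` and `φ ((0,1]) ⊆ U`. -/
def IsEndCut (U : Set Plane) (x : Plane) (φ : unitInterval → Plane) : Prop :=
  Continuous φ ∧ Function.Injective φ ∧ φ 0 = x ∧
    ∀ t : unitInterval, t ≠ 0 → φ t ∈ U

/-- The point `x` (on the frontier of `U`) is accessible from `U`. -/
def Accessible (U : Set Plane) (x : Plane) : Prop :=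
  x ∈ frontier U ∧ ∃ φ : unitInterval → Plane, IsEndCut U x φ

/-- `ψ` is a cross-cut of the open set `U`: an injective continuous map `[0,1] → ℝ²`
with `ψ 0, ψ 1 ∈ frontier U` and `ψ ((0,1)) ⊆ U`. -/
def IsCrossCut (U : Set Plane) (ψ : unitInterval → Plane) : Prop :=
  Continuous ψ ∧ Function.Injective ψ ∧ ψ 0 ∈ frontier U ∧ ψ 1 ∈ frontier U ∧
    ∀ t : unitInterval, t ≠ 0 → t ≠ 1 → ψ t ∈ U

/-- `K` is a compact set whose complement has exactly two connected components
`W₁` and `W₂`. -/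
def TwoSided (K W₁ W₂ : Set Plane) : Prop :=
  IsCompact K ∧ W₁ ≠ W₂ ∧
    (∃ x ∈ Kᶜ, connectedComponentIn Kᶜ x = W₁) ∧
    (∃ x ∈ Kᶜ, connectedComponentIn Kᶜ x = W₂) ∧
    ∀ x ∈ Kᶜ, connectedComponentIn Kᶜ x = W₁ ∨ connectedComponentIn Kᶜ x = W₂

/-- The set of points of `K` accessible from `W`. -/
def AccPts (K W : Set Plane) : Set Plane := {x ∈ K | Accessible W x}

/-- `R` is sufficiently dense in `F`: for every `x ∈ F` and every open neighborhood `U`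
of `x`, the connected component `F(U,x)` of `x` in `F ∩ U` meets `R`. -/
def SuffDense (F R : Set Plane) : Prop :=
  ∀ x ∈ F, ∀ U : Set Plane, IsOpen U → x ∈ U →
    (connectedComponentIn (F ∩ U) x ∩ R).Nonempty

/-- `K` is a d-set: a two-sided set such that both `A₁` and `A₂` are sufficiently
dense in `K`. -/
def IsDSet (K W₁ W₂ : Set Plane) : Prop :=
  TwoSided K W₁ W₂ ∧ SuffDense K (AccPts K W₁) ∧ SuffDense K (AccPts K W₂)

/-- `K` is a simple set: a two-sided set such that both `A₁` and `A₂` are dense in `K`. -/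
def IsSimpleSet (K W₁ W₂ : Set Plane) : Prop :=
  TwoSided K W₁ W₂ ∧ K ⊆ closure (AccPts K W₁) ∧ K ⊆ closure (AccPts K W₂)

/-- `K` is a simple closed curve: it is homeomorphic to the unit circle. -/
def IsSimpleClosedCurve (K : Set Plane) : Prop :=
  Nonempty (K ≃ₜ (Metric.sphere (0 : Plane) 1 : Set Plane))

/-- The topology `LC(X)` generated by the connected components of open subsets of `X`. -/
def LC (X : Type*) [TopologicalSpace X] : TopologicalSpace X :=
  TopologicalSpace.generateFrom
    {C : Set X | ∃ U : Set X, IsOpen U ∧ ∃ x ∈ U, connectedComponentIn U x = C}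

/-- A topological space is zero-dimensional if it has a basis of clopen sets. -/
def ZeroDimensional (X : Type*) [TopologicalSpace X] : Prop :=
  ∀ (x : X) (U : Set X), IsOpen U → x ∈ U →
    ∃ V : Set X, IsClopen V ∧ x ∈ V ∧ V ⊆ U

/-- `f` has a continuous logarithm on `X`. -/
def HasLogOn (f : ℂ → ℂ) (X : Set ℂ) : Prop :=
  ∃ g : ℂ → ℂ, ContinuousOn g X ∧ ∀ z ∈ X, Complex.exp (g z) = f z

namespace HasLogOn

variable {f f₁ f₂ : ℂ → ℂ} {X Y : Set ℂ}

theorem mono (h : HasLogOn f Y) (hXY : X ⊆ Y) : HasLogOn f X :=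
  let ⟨g, hg, hgf⟩ := h
  ⟨g, hg.mono hXY, fun z hz => hgf z (hXY hz)⟩

theorem congr (h : HasLogOn f₁ X) (hf : EqOn f₁ f₂ X) : HasLogOn f₂ X :=
  let ⟨g, hg, hgf⟩ := h
  ⟨g, hg, fun z hz => (hgf z hz).trans (hf hz)⟩

theorem mul (h₁ : HasLogOn f₁ X) (h₂ : HasLogOn f₂ X) :
    HasLogOn (fun z => f₁ z * f₂ z) X :=
  let ⟨g₁, hg₁, hf₁⟩ := h₁
  let ⟨g₂, hg₂, hf₂⟩ := h₂
  ⟨fun z => g₁ z + g₂ z, hg₁.add hg₂, fun z hz => by rw [Complex.exp_add, hf₁ z hz, hf₂ z hz]⟩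

theorem inv (h : HasLogOn f X) : HasLogOn (fun z => (f z)⁻¹) X :=
  let ⟨g, hg, hgf⟩ := h
  ⟨fun z => -g z, hg.neg, fun z hz => by rw [Complex.exp_neg, hgf z hz]⟩

/-- Logarithms on two closed sets which agree on the intersection can be glued. -/
theorem glue {g₁ g₂ : ℂ → ℂ} (hX : IsClosed X) (hY : IsClosed Y)
    (hg₁ : ContinuousOn g₁ X) (hg₂ : ContinuousOn g₂ Y)
    (h₁ : ∀ z ∈ X, Complex.exp (g₁ z) = f z) (h₂ : ∀ z ∈ Y, Complex.exp (g₂ z) = f z)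
    (hXY : EqOn g₁ g₂ (X ∩ Y)) : HasLogOn f (X ∪ Y) := by
  classical
  have hX' : EqOn (X.piecewise g₁ g₂) g₁ X := X.piecewise_eqOn g₁ g₂
  have hY' : EqOn (X.piecewise g₁ g₂) g₂ Y := fun z hz => by
    by_cases hzX : z ∈ X
    · rw [hX' hzX, hXY ⟨hzX, hz⟩]
    · exact piecewise_eq_of_notMem _ _ _ hzX
  refine ⟨X.piecewise g₁ g₂,
    (hg₁.congr hX').union_of_isClosed (hg₂.congr hY') hX hY, ?_⟩
  rintro z (hz | hz)
  · rw [hX' hz, h₁ z hz]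
  · rw [hY' hz, h₂ z hz]

end HasLogOn

/-- Two continuous logarithms of the same function differ by a constant on preconnected sets. -/
theorem IsPreconnected.sub_eq_sub_of_exp_eq {α : Type*} [TopologicalSpace α] {s : Set α}
    (hs : IsPreconnected s) {g₁ g₂ : α → ℂ} (hg₁ : ContinuousOn g₁ s) (hg₂ : ContinuousOn g₂ s)
    (h : ∀ z ∈ s, Complex.exp (g₁ z) = Complex.exp (g₂ z)) {x y : α} (hx : x ∈ s) (hy : y ∈ s) :
    g₁ x - g₂ x = g₁ y - g₂ y := by
  have hc : (range fun n : ℤ => (n : ℂ) * (2 * Real.pi * Complex.I)).Countable :=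
    countable_range _
  refine hc.isTotallyDisconnected ((fun z => g₁ z - g₂ z) '' s) ?_ (hs.image _ (hg₁.sub hg₂))
    (mem_image_of_mem _ hx) (mem_image_of_mem _ hy)
  rintro _ ⟨z, hz, rfl⟩
  obtain ⟨n, hn⟩ := Complex.exp_eq_exp_iff_exists_int.1 (h z hz)
  exact ⟨n, by simp [hn]⟩

theorem HasLogOn.union {f : ℂ → ℂ} {X Y : Set ℂ} (hX : IsClosed X) (hY : IsClosed Y)
    (hXY : IsPreconnected (X ∩ Y)) (h₁ : HasLogOn f X) (h₂ : HasLogOn f Y) :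
    HasLogOn f (X ∪ Y) := by
  obtain ⟨g₁, hg₁, hf₁⟩ := h₁
  obtain ⟨g₂, hg₂, hf₂⟩ := h₂
  rcases (X ∩ Y).eq_empty_or_nonempty with h | ⟨w, hw⟩
  · exact .glue hX hY hg₁ hg₂ hf₁ hf₂ (by simp [h])
  have key : ∀ z ∈ X ∩ Y, g₁ z - g₂ z = g₁ w - g₂ w := fun z hz =>
    hXY.sub_eq_sub_of_exp_eq (hg₁.mono inter_subset_left) (hg₂.mono inter_subset_right)
      (fun u hu => (hf₁ u hu.1).trans (hf₂ u hu.2).symm) hz hw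
  refine .glue (g₂ := fun z => g₂ z + (g₁ w - g₂ w)) hX hY hg₁ (hg₂.add continuousOn_const) hf₁
    (fun z hz => ?_) fun z hz => by rw [← key z hz]; ring
  rw [Complex.exp_add, Complex.exp_sub, hf₁ w hw.1, hf₂ w hw.2, hf₂ z hz, div_self, mul_one]
  rw [← hf₁ w hw.1]
  exact Complex.exp_ne_zero _

/-- A continuous non-vanishing function on a real normed space has a continuous logarithm. -/
theorem exists_continuous_log {E : Type*} [NormedAddCommGroup E] [NormedSpace ℝ E] {f : E → ℂ}
    (hf : Continuous f) (h0 : ∀ z, f z ≠ 0) :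
    ∃ g : E → ℂ, Continuous g ∧ ∀ z, Complex.exp (g z) = f z := by
  have hs : IsSimplyConnected (univ : Set E) :=
    (Homeomorph.Set.univ E).toHomotopyEquiv.simplyConnectedSpace_iff.2 inferInstance
  obtain ⟨g, hg, hgf⟩ := Complex.exists_continuousOn_eqOn_exp_comp hs isOpen_univ
    hf.continuousOn (by rintro ⟨z, -, hz⟩; exact h0 z hz)
  exact ⟨g, continuousOn_univ.1 hg, fun z => hgf (mem_univ z)⟩

/-- If `U` is a bounded open set with frontier in the compact set `X` and `q ∈ U`, then
`(z - q) ^ k` does not have a continuous logarithm on `X`, even after multiplication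
by a function without zeros on `closure U`. -/
theorem not_hasLogOn_zpow_mul {U X : Set ℂ} (hU : IsOpen U) (hUb : Bornology.IsBounded U)
    (hX : IsCompact X) (hUX : frontier U ⊆ X) {q : ℂ} (hq : q ∈ U) {u : ℂ → ℂ}
    (hu : ContinuousOn u (closure U)) (hu0 : ∀ z ∈ closure U, u z ≠ 0) {k : ℤ} (hk : k ≠ 0) :
    ¬ HasLogOn (fun z => (z - q) ^ k * u z) X := by
  classical
  rintro ⟨g, hg, hgf⟩
  obtain ⟨G, hG⟩ := ContinuousMap.exists_restrict_eq hX.isClosed ⟨X.domRestrict g, hg.domRestrict⟩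
  have hGg : ∀ z ∈ X, G z = g z := fun z hz => DFunLike.congr_fun hG ⟨z, hz⟩
  let H : ℂ → ℂ := (closure U).piecewise (fun z => Complex.exp (G z) / u z) fun z => (z - q) ^ k
  have h₁ : EqOn H (fun z => Complex.exp (G z) / u z) (closure U) := piecewise_eqOn _ _ _
  have h₂ : EqOn H (fun z => (z - q) ^ k) Uᶜ := fun z hz => by
    by_cases hzU : z ∈ closure U
    · have hzX : z ∈ X := hUX (by rw [hU.frontier_eq]; exact ⟨hzU, hz⟩)
      rw [h₁ hzU]
      simp only [hGg z hzX, hgf z hzX]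
      exact mul_div_cancel_right₀ _ (hu0 z hzU)
    · exact piecewise_eq_of_notMem _ _ _ hzU
  have hsub : ∀ z ∈ Uᶜ, z - q ≠ 0 := fun z hz h => hz (by rwa [sub_eq_zero.1 h])
  have hHc : Continuous H := by
    rw [← continuousOn_univ]
    have : (univ : Set ℂ) = closure U ∪ Uᶜ :=
      (eq_univ_of_univ_subset fun z _ => (em (z ∈ U)).imp (fun h => subset_closure h) id).symm
    rw [this]
    refine ContinuousOn.union_of_isClosed ?_ ?_ isClosed_closure hU.isClosed_compl
    · exact ContinuousOn.congr ((Complex.continuous_exp.comp G.continuous).continuousOn.div hu hu0) h₁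
    · exact ContinuousOn.congr ((continuousOn_id.sub continuousOn_const).zpow₀ k
        fun z hz => Or.inl (hsub z hz)) h₂
  have hH0 : ∀ z, H z ≠ 0 := fun z => by
    by_cases hz : z ∈ U
    · rw [h₁ (subset_closure hz)]
      exact div_ne_zero (Complex.exp_ne_zero _) (hu0 z (subset_closure hz))
    · rw [h₂ hz]
      exact zpow_ne_zero _ (hsub z hz)
  obtain ⟨L, hL, hLH⟩ := exists_continuous_log hHc hH0
  obtain ⟨R, hR, hUR⟩ := hUb.subset_ball_lt 0 q
  let c : ℝ → ℂ := fun t => q + Complex.exp (Real.log R + t * Complex.I)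
  have hcU : ∀ t, c t ∉ U := fun t ht => by
    have := hUR ht
    simp [c, Complex.norm_exp, Real.exp_log hR] at this
  have hconst := isPreconnected_univ.sub_eq_sub_of_exp_eq (s := (univ : Set ℝ))
    (g₁ := fun t => L (c t)) (g₂ := fun t => k * (Real.log R + t * Complex.I))
    (by fun_prop) (by fun_prop) (fun t _ => by
      rw [hLH, h₂ (hcU t), Complex.exp_int_mul]
      simp [c]) (mem_univ 0) (mem_univ (2 * Real.pi))
  have hc : c (2 * Real.pi) = c 0 := by simp [c, Complex.exp_add, Complex.exp_two_pi_mul_I]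
  rw [hc] at hconst
  have : (k : ℂ) * (2 * Real.pi * Complex.I) = 0 := by
    push_cast at hconst
    linear_combination hconst
  simp [hk, Real.pi_ne_zero] at this

/-- Points in a preconnected set disjoint from `X` are not separated by `X`. -/
theorem IsPreconnected.hasLogOn_div {P X : Set ℂ} (hP : IsPreconnected P) (hX : IsClosed X)
    (hPX : P ⊆ Xᶜ) {p q : ℂ} (hp : p ∈ P) (hq : q ∈ P) :
    HasLogOn (fun z => (z - p) / (z - q)) X := by
  have hne : ∀ p ∈ P, ∀ z ∈ X, z - p ≠ 0 := fun p hp z hz h =>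
    hPX hp (by rwa [← sub_eq_zero.1 h])
  refine hP.induction₂ (fun p q => HasLogOn (fun z => (z - p) / (z - q)) X) ?_ ?_ ?_ hp hq
  · intro p hp
    obtain ⟨r, hr, hrX⟩ := Metric.isOpen_iff.1 hX.isOpen_compl p (hPX hp)
    filter_upwards [mem_nhdsWithin_of_mem_nhds (ball_mem_nhds p hr), self_mem_nhdsWithin]
      with q hq hqP
    have hslit : ∀ z ∈ X, (z - q) / (z - p) ∈ Complex.slitPlane := fun z hz => by
      apply Complex.mem_slitPlane_of_norm_lt_one (z := (z - q) / (z - p) - 1) _ |> fun h => by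
        simpa using h
      have h1 : (z - q) / (z - p) - 1 = (p - q) / (z - p) := by
        rw [div_sub_one (hne p hp z hz)]; ring
      rw [h1, norm_div, div_lt_one (norm_pos_iff.2 (hne p hp z hz))]
      have h2 : ¬ dist z p < r := fun h => hrX h hz
      rw [mem_ball', dist_eq_norm] at hq
      rw [dist_eq_norm] at h2
      linarith
    refine HasLogOn.congr (f₁ := fun z => ((z - q) / (z - p))⁻¹) (.inv
      ⟨fun z => Complex.log ((z - q) / (z - p)), ?_, fun z hz =>
        Complex.exp_log (Complex.slitPlane_ne_zero (hslit z hz))⟩) fun z _ => inv_div _ _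
    refine ContinuousOn.clog (ContinuousOn.div (by fun_prop) (by fun_prop) (hne p hp)) hslit
  · intro x y w hx hy hw h₁ h₂
    refine (h₁.mul h₂).congr fun z hz => ?_
    have := hne y hy z hz
    have := hne w hw z hz
    simp only
    field_simp
  · intro x y hx hy h
    exact h.inv.congr fun z _ => inv_div _ _

theorem IsClosed.frontier_connectedComponentIn_compl_subset {α : Type*} [TopologicalSpace α]
    [LocallyConnectedSpace α] {X : Set α} (hX : IsClosed X) (p : α) :
    frontier (connectedComponentIn Xᶜ p) ⊆ X := by
  intro z hz
  by_contra hzX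
  have hU := hX.isOpen_compl.connectedComponentIn (x := p)
  rw [hU.frontier_eq] at hz
  obtain ⟨w, hwz, hwp⟩ := mem_closure_iff.1 hz.1 _ (hX.isOpen_compl.connectedComponentIn (x := z))
    (mem_connectedComponentIn hzX)
  refine hz.2 ?_
  rw [connectedComponentIn_eq hwp, ← connectedComponentIn_eq hwz]
  exact mem_connectedComponentIn hzX

theorem connectedComponentIn_eq_of_mem_closure {α : Type*} [TopologicalSpace α]
    [LocallyConnectedSpace α] {X : Set α} (hX : IsClosed X) {p q : α} (hq : q ∈ Xᶜ)
    (h : q ∈ closure (connectedComponentIn Xᶜ p)) :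
    connectedComponentIn Xᶜ p = connectedComponentIn Xᶜ q := by
  refine connectedComponentIn_eq ?_
  by_contra hqp
  refine hq (hX.frontier_connectedComponentIn_compl_subset p ?_)
  rw [hX.isOpen_compl.connectedComponentIn.frontier_eq]
  exact ⟨h, hqp⟩

/-- A compact plane set has at most one unbounded complementary component. -/
theorem IsCompact.isBounded_connectedComponentIn_compl {X : Set ℂ} (hX : IsCompact X) {p q : ℂ}
    (hpq : connectedComponentIn Xᶜ p ≠ connectedComponentIn Xᶜ q) :
    Bornology.IsBounded (connectedComponentIn Xᶜ p) ∨
      Bornology.IsBounded (connectedComponentIn Xᶜ q) := by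
  obtain ⟨R, hR, hXR⟩ := hX.isBounded.subset_closedBall_lt 0 0
  let E : Set ℂ := Complex.exp '' {w | Real.log R < w.re}
  have hE : IsPreconnected E :=
    ((convex_halfSpace_re_gt _).isPreconnected).image _ Complex.continuous_exp.continuousOn
  have hmem : ∀ z : ℂ, R < ‖z‖ → z ∈ E := fun z hz => by
    have hz0 : z ≠ 0 := norm_pos_iff.1 (hR.trans hz)
    exact ⟨Complex.log z, by simpa [Complex.log_re] using Real.log_lt_log hR hz,
      Complex.exp_log hz0⟩
  have hEX : E ⊆ Xᶜ := by
    rintro _ ⟨w, hw, rfl⟩ hwX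
    have h1 := hXR hwX
    rw [mem_closedBall_zero_iff, Complex.norm_exp, ← Real.le_log_iff_exp_le hR] at h1
    exact absurd hw (not_lt.2 h1)
  have key : ∀ p, ¬ Bornology.IsBounded (connectedComponentIn Xᶜ p) →
      ∃ z ∈ E, z ∈ connectedComponentIn Xᶜ p := fun p hp => by
    by_contra! h
    refine hp (isBounded_closedBall (x := (0 : ℂ)) (r := R) |>.subset fun z hz => ?_)
    by_contra hzR
    exact h z (hmem z (by simpa using hzR)) hz
  by_contra! h
  obtain ⟨z, hzE, hz⟩ := key p h.1
  obtain ⟨w, hwE, hw⟩ := key q h.2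
  refine hpq ?_
  rw [connectedComponentIn_eq hz, connectedComponentIn_eq hw]
  exact connectedComponentIn_eq (hE.subset_connectedComponentIn hzE hEX hwE)

/-- **Borsuk's criterion**: if `(z - p) / (z - q)` has a continuous logarithm on the compact
set `X`, then `X` does not separate `p` and `q`. -/
theorem HasLogOn.connectedComponentIn_eq {X : Set ℂ} (hX : IsCompact X) {p q : ℂ}
    (hp : p ∈ Xᶜ) (hq : q ∈ Xᶜ) (h : HasLogOn (fun z => (z - p) / (z - q)) X) :
    connectedComponentIn Xᶜ p = connectedComponentIn Xᶜ q := by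
  by_contra hpq
  wlog hb : Bornology.IsBounded (connectedComponentIn Xᶜ p) generalizing p q
  · exact this hq hp (h.inv.congr fun z _ => inv_div _ _) (Ne.symm hpq)
      ((hX.isBounded_connectedComponentIn_compl hpq).resolve_left hb)
  have hqU : ∀ z ∈ closure (connectedComponentIn Xᶜ p), z - q ≠ 0 := by
    intro z hz hzq
    rw [sub_eq_zero.1 hzq] at hz
    exact hpq (connectedComponentIn_eq_of_mem_closure hX.isClosed hq hz)
  refine not_hasLogOn_zpow_mul hX.isClosed.isOpen_compl.connectedComponentIn hb hX
    (hX.isClosed.frontier_connectedComponentIn_compl_subset p) (mem_connectedComponentIn hp)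
    (u := fun z => (z - q)⁻¹) (ContinuousOn.inv₀ (by fun_prop) hqU)
    (fun z hz => inv_ne_zero (hqU z hz)) one_ne_zero (h.congr fun z _ => ?_)
  simp [div_eq_mul_inv]

/-- A compact subset of a connected open plane set lies in a compact connected subset. -/
theorem IsCompact.exists_isPreconnected_superset {K W : Set ℂ} (hK : IsCompact K)
    (hW : IsOpen W) (hWc : IsPreconnected W) (hKW : K ⊆ W) :
    ∃ Z, IsCompact Z ∧ IsPreconnected Z ∧ K ⊆ Z ∧ Z ⊆ W := by
  rcases K.eq_empty_or_nonempty with rfl | ⟨w, hw⟩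
  · exact ⟨∅, isCompact_empty, isPreconnected_empty, Subset.rfl, empty_subset _⟩
  have hwW := hKW hw
  have hWp : IsPathConnected W := hW.isConnected_iff_isPathConnected.1 ⟨⟨w, hwW⟩, hWc⟩
  suffices ∃ Z, IsCompact Z ∧ IsPreconnected Z ∧ w ∈ Z ∧ K ⊆ Z ∧ Z ⊆ W by
    obtain ⟨Z, h1, h2, -, h3⟩ := this
    exact ⟨Z, h1, h2, h3⟩
  refine hK.induction_on
    (p := fun s => ∃ Z, IsCompact Z ∧ IsPreconnected Z ∧ w ∈ Z ∧ s ⊆ Z ∧ Z ⊆ W) ?_ ?_ ?_ ?_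
  · exact ⟨{w}, isCompact_singleton, isPreconnected_singleton, rfl, empty_subset _,
      singleton_subset_iff.2 hwW⟩
  · rintro s t hst ⟨Z, h1, h2, h3, h4, h5⟩
    exact ⟨Z, h1, h2, h3, hst.trans h4, h5⟩
  · rintro s t ⟨Z, h1, h2, h3, h4, h5⟩ ⟨Z', h1', h2', h3', h4', h5'⟩
    exact ⟨Z ∪ Z', h1.union h1', h2.union w h3 h3' h2', Or.inl h3, union_subset_union h4 h4',
      union_subset h5 h5'⟩
  · intro x hx
    obtain ⟨r, hr, hrW⟩ := Metric.nhds_basis_closedBall.mem_iff.1 (hW.mem_nhds (hKW hx))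
    obtain ⟨γ, hγ⟩ := hWp.joinedIn w hwW x (hKW hx)
    refine ⟨closedBall x r, mem_nhdsWithin_of_mem_nhds (closedBall_mem_nhds x hr),
      range γ ∪ closedBall x r, (isCompact_range γ.continuous).union (isCompact_closedBall x r),
      (isPreconnected_range γ.continuous).union x ⟨1, γ.target⟩ (mem_closedBall_self hr.le)
        (convex_closedBall x r).isPreconnected, Or.inl ⟨0, γ.source⟩, subset_union_right,
      union_subset (range_subset_iff.2 hγ) hrW⟩

/-- Two plane continua meeting in exactly two points separate the plane. -/
theorem not_isPreconnected_compl_union {X Y : Set ℂ} (hX : IsCompact X) (hY : IsCompact Y)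
    (hXc : IsPreconnected X) (hYc : IsPreconnected Y) {a b : ℂ} (hab : a ≠ b)
    (hXY : X ∩ Y = {a, b}) : ¬ IsPreconnected (X ∪ Y)ᶜ := by
  intro hcon
  have ha : a ∈ X ∩ Y := by simp [hXY]
  have hb : b ∈ X ∩ Y := by simp [hXY]
  have hd : 0 < dist b a := dist_pos.2 hab.symm
  have hT : sphere a (dist b a / 2) ⊆ Xᶜ ∪ Yᶜ := by
    rw [← compl_inter, hXY]
    rintro z hz (rfl | rfl)
    · rw [mem_sphere, dist_self] at hz
      linarith
    · rw [mem_sphere] at hz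
      linarith
  obtain ⟨T₁, T₂, hT₁, hT₂, hT₁X, hT₂Y, hTu⟩ := (isCompact_sphere a (dist b a / 2)).binary_compact_cover
    hX.isClosed.isOpen_compl hY.isClosed.isOpen_compl hT
  obtain ⟨Z, hZ, hZc, hTZ, hZXY⟩ := (hT₁.inter hT₂).exists_isPreconnected_superset
    (hX.union hY).isClosed.isOpen_compl hcon
    (by rw [compl_union]; exact inter_subset_inter hT₁X hT₂Y)
  rw [compl_union] at hZXY
  have h₁ := hXc.hasLogOn_div (X := T₁ ∪ Z) (hT₁.union hZ).isClosed
    (subset_compl_comm.1 (union_subset hT₁X (hZXY.trans inter_subset_left))) ha.1 hb.1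
  have h₂ := hYc.hasLogOn_div (X := T₂ ∪ Z) (hT₂.union hZ).isClosed
    (subset_compl_comm.1 (union_subset hT₂Y (hZXY.trans inter_subset_right))) ha.2 hb.2
  have hZ' : (T₁ ∪ Z) ∩ (T₂ ∪ Z) = Z := by
    rw [← inter_union_distrib_right]
    exact union_eq_right.2 hTZ
  have h := (HasLogOn.union (hT₁.union hZ).isClosed (hT₂.union hZ).isClosed
    (by rwa [hZ']) h₁ h₂).mono (X := sphere a (dist b a / 2)) (by
      rw [hTu]; exact union_subset_union subset_union_left subset_union_left)
  have hbU : ∀ z ∈ closure (ball a (dist b a / 2)), z - b ≠ 0 := fun z hz hzb => by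
    have := closure_ball_subset_closedBall hz
    rw [sub_eq_zero.1 hzb, mem_closedBall] at this
    linarith
  refine not_hasLogOn_zpow_mul isOpen_ball isBounded_ball (isCompact_sphere a (dist b a / 2))
    frontier_ball_subset_sphere (mem_ball_self (half_pos hd)) (u := fun z => (z - b)⁻¹)
    (ContinuousOn.inv₀ (by fun_prop) hbU) (fun z hz => inv_ne_zero (hbU z hz)) one_ne_zero
    (h.congr fun z _ => ?_)
  simp [div_eq_mul_inv]

/-- A continuous function without zeros has a continuous logarithm on an arc. -/
theorem hasLogOn_image_Icc {β : unitInterval → ℂ} (hβ : Continuous β)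
    (hinj : Function.Injective β) {s t : unitInterval} (hst : s ≤ t) {f : ℂ → ℂ}
    (hf : ContinuousOn f (β '' Icc s t)) (h0 : ∀ z ∈ β '' Icc s t, f z ≠ 0) :
    HasLogOn f (β '' Icc s t) := by
  have hmem : ∀ r : ℝ, β (projIcc s t hst (projIcc 0 1 zero_le_one r)) ∈ β '' Icc s t :=
    fun r => mem_image_of_mem _ (Subtype.coe_prop _)
  obtain ⟨g, hg, hgf⟩ := exists_continuous_log (E := ℝ)
    (f := fun r => f (β (projIcc s t hst (projIcc 0 1 zero_le_one r))))
    (hf.comp_continuous (hβ.comp (continuous_subtype_val.comp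
      (continuous_projIcc.comp continuous_projIcc))) hmem) (fun r => h0 _ (hmem r))
  obtain ⟨G, hG⟩ := ContinuousMap.exists_extension (hβ.isClosedEmbedding hinj)
    ⟨fun r : unitInterval => g r, by fun_prop⟩
  refine ⟨G, G.continuous.continuousOn, ?_⟩
  rintro _ ⟨r, hr, rfl⟩
  have : G (β r) = g r := DFunLike.congr_fun hG r
  rw [this, hgf, projIcc_val, projIcc_of_mem hst hr]

/-- Attaching a subarc along a connected set to a non-separating compact set does not
separate the plane. -/
theorem isPreconnected_compl_union_image_Icc {X : Set ℂ} (hX : IsCompact X)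
    (hXo : IsPreconnected Xᶜ) {β : unitInterval → ℂ} (hβ : Continuous β)
    (hinj : Function.Injective β) {s t : unitInterval} (hst : s ≤ t)
    (hXJ : IsPreconnected (X ∩ β '' Icc s t)) :
    IsPreconnected (X ∪ β '' Icc s t)ᶜ := by
  have hJc : IsCompact (β '' Icc s t) := isCompact_Icc.image hβ
  have hne : ∀ w ∈ (X ∪ β '' Icc s t)ᶜ, ∀ z ∈ β '' Icc s t, z - w ≠ 0 := fun w hw z hz h =>
    hw (Or.inr (by rwa [← sub_eq_zero.1 h]))
  have hsub : (X ∪ β '' Icc s t)ᶜ ⊆ Xᶜ := compl_subset_compl.2 subset_union_left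
  refine isPreconnected_of_forall_pair fun p hp q hq => ?_
  have h₁ := hXo.hasLogOn_div hX.isClosed Subset.rfl (hsub hp) (hsub hq)
  have h₂ : HasLogOn (fun z => (z - p) / (z - q)) (β '' Icc s t) :=
    hasLogOn_image_Icc hβ hinj hst (ContinuousOn.div (by fun_prop) (by fun_prop) (hne q hq))
      fun z hz => div_ne_zero (hne p hp z hz) (hne q hq z hz)
  have h := (h₁.union hX.isClosed hJc.isClosed hXJ h₂).connectedComponentIn_eq (hX.union hJc) hp hq
  refine ⟨_, connectedComponentIn_subset _ p, mem_connectedComponentIn hp, ?_,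
    isPreconnected_connectedComponentIn⟩
  rw [h]
  exact mem_connectedComponentIn hq

/-- A function with logarithms on `X` and on `Y` has logarithms whose difference is zero at
a given point of `X ∩ Y` and a multiple of `2πi` at another one. -/
theorem exists_log_defect {X Y : Set ℂ} {f : ℂ → ℂ} (h₁ : HasLogOn f X) (h₂ : HasLogOn f Y)
    {a b : ℂ} (ha : a ∈ X ∩ Y) (hb : b ∈ X ∩ Y) :
    ∃ (g₁ g₂ : ℂ → ℂ) (n : ℤ), ContinuousOn g₁ X ∧ ContinuousOn g₂ Y ∧
      (∀ z ∈ X, Complex.exp (g₁ z) = f z) ∧ (∀ z ∈ Y, Complex.exp (g₂ z) = f z) ∧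
      g₁ a = g₂ a ∧ g₁ b = g₂ b + n * (2 * Real.pi * Complex.I) := by
  obtain ⟨g₁, hg₁, hf₁⟩ := h₁
  obtain ⟨g₂, hg₂, hf₂⟩ := h₂
  obtain ⟨m, hm⟩ := Complex.exp_eq_exp_iff_exists_int.1 ((hf₁ a ha.1).trans (hf₂ a ha.2).symm)
  obtain ⟨n, hn⟩ := Complex.exp_eq_exp_iff_exists_int.1 ((hf₁ b hb.1).trans (hf₂ b hb.2).symm)
  refine ⟨g₁, fun z => g₂ z + m * (2 * Real.pi * Complex.I), n - m, hg₁,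
    hg₂.add continuousOn_const, hf₁, fun z hz => ?_, hm, ?_⟩
  · rw [Complex.exp_add, Complex.exp_int_mul_two_pi_mul_I, mul_one, hf₂ z hz]
  · rw [hn]; push_cast; ring

/-- `β` is an arc whose end-points, and no other points, lie in `C`. -/
structure IsArcAttachedTo {α : Type*} [TopologicalSpace α] (β : unitInterval → α) (C : Set α) :
    Prop where
  continuous : Continuous β
  injective : Function.Injective β
  zero_mem : β 0 ∈ C
  one_mem : β 1 ∈ C
  notMem : ∀ t, t ≠ 0 → t ≠ 1 → β t ∉ C

namespace IsArcAttachedTo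

theorem inter_range {α : Type*} [TopologicalSpace α] {β : unitInterval → α} {C : Set α}
    (h : IsArcAttachedTo β C) : C ∩ range β = {β 0, β 1} := by
  ext z
  constructor
  · rintro ⟨hz, t, rfl⟩
    by_contra hc
    simp only [mem_insert_iff, mem_singleton_iff, not_or] at hc
    exact h.notMem t (fun h => hc.1 (by rw [h])) (fun h => hc.2 (by rw [h])) hz
  · rintro (rfl | rfl)
    · exact ⟨h.zero_mem, 0, rfl⟩
    · exact ⟨h.one_mem, 1, rfl⟩

variable {β : unitInterval → ℂ} {C : Set ℂ}

theorem not_isPreconnected_compl (h : IsArcAttachedTo β C) (hC : IsCompact C)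
    (hCc : IsPreconnected C) : ¬ IsPreconnected (C ∪ range β)ᶜ :=
  not_isPreconnected_compl_union hC (isCompact_range h.continuous) hCc
    (isPreconnected_range h.continuous) (h.injective.ne zero_ne_one) h.inter_range

/-- Removing a nondegenerate piece of the attached arc leaves a non-separating set. -/
theorem isPreconnected_compl_of_lt (h : IsArcAttachedTo β C) (hC : IsCompact C)
    (hCo : IsPreconnected Cᶜ) {s t : unitInterval} (hst : s < t) :
    IsPreconnected (C ∪ β '' Icc 0 s ∪ β '' Icc t 1)ᶜ := by
  have hs : s < 1 := hst.trans_le unitInterval.le_one'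
  have ht : 0 < t := unitInterval.nonneg'.trans_lt hst
  have h0 : C ∩ β '' Icc 0 s = {β 0} := by
    refine Subset.antisymm ?_ (singleton_subset_iff.2
      ⟨h.zero_mem, mem_image_of_mem _ ⟨le_rfl, unitInterval.nonneg'⟩⟩)
    rintro _ ⟨hz, r, hr, rfl⟩
    by_cases hr0 : r = 0
    · rw [hr0]; rfl
    · exact absurd hz (h.notMem r hr0 (hr.2.trans_lt hs).ne)
  have h1 : (C ∪ β '' Icc 0 s) ∩ β '' Icc t 1 = {β 1} := by
    refine Subset.antisymm ?_ (singleton_subset_iff.2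
      ⟨Or.inl h.one_mem, mem_image_of_mem _ ⟨unitInterval.le_one', le_rfl⟩⟩)
    rintro _ ⟨hz, r, hr, rfl⟩
    by_cases hr1 : r = 1
    · rw [hr1]; rfl
    · rcases hz with hz | ⟨r', hr', hrr'⟩
      · exact absurd hz (h.notMem r (ht.trans_le hr.1).ne' hr1)
      · rw [h.injective hrr'] at hr'
        exact absurd (hr'.2.trans_lt (hst.trans_le hr.1)) (lt_irrefl _)
  refine isPreconnected_compl_union_image_Icc (hC.union (isCompact_Icc.image h.continuous)) ?_
    h.continuous h.injective unitInterval.le_one' (h1 ▸ isPreconnected_singleton)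
  exact isPreconnected_compl_union_image_Icc hC hCo h.continuous h.injective unitInterval.nonneg'
    (h0 ▸ isPreconnected_singleton)

/-- Every complementary component of `C ∪ range β` has all interior points of the arc on its
frontier. -/
theorem mem_frontier_connectedComponentIn (h : IsArcAttachedTo β C) (hC : IsCompact C)
    (hCc : IsPreconnected C) (hCo : IsPreconnected Cᶜ) {z : ℂ} (hz : z ∈ (C ∪ range β)ᶜ)
    {r : unitInterval} (hr0 : r ≠ 0) (hr1 : r ≠ 1) :
    β r ∈ frontier (connectedComponentIn (C ∪ range β)ᶜ z) := by
  have hS : IsClosed (C ∪ range β) := (hC.union (isCompact_range h.continuous)).isClosed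
  set V := connectedComponentIn (C ∪ range β)ᶜ z with hV
  have hVo : IsOpen V := hS.isOpen_compl.connectedComponentIn
  have hVS : V ⊆ (C ∪ range β)ᶜ := connectedComponentIn_subset _ _
  rw [hVo.frontier_eq]
  refine ⟨?_, fun hr => hVS hr (Or.inr (mem_range_self r))⟩
  by_contra hr
  have hnhds : β ⁻¹' (closure V)ᶜ ∈ 𝓝 r :=
    (isClosed_closure.isOpen_compl.preimage h.continuous).mem_nhds hr
  obtain ⟨s, t, hrst, hst⟩ := (mem_nhds_iff_exists_Ioo_subset'
    ⟨0, unitInterval.pos_iff_ne_zero.2 hr0⟩ ⟨1, unitInterval.lt_one_iff_ne_one.2 hr1⟩).1 hnhds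
  set S' := C ∪ β '' Icc 0 s ∪ β '' Icc t 1 with hS'
  have hS'S : S' ⊆ C ∪ range β :=
    union_subset (union_subset_union_right _ (image_subset_range _ _))
      ((image_subset_range _ _).trans subset_union_right)
  have hfr : frontier V ⊆ S' := fun w hw => by
    rcases hS.frontier_connectedComponentIn_compl_subset z hw with hwC | ⟨q, rfl⟩
    · exact Or.inl (Or.inl hwC)
    · have hq : ¬ (s < q ∧ q < t) := fun hq => hst hq hw.1
      rcases le_or_gt q s with hqs | hqs
      · exact Or.inl (Or.inr (mem_image_of_mem _ ⟨unitInterval.nonneg', hqs⟩))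
      · exact Or.inr (mem_image_of_mem _ ⟨not_lt.1 fun h => hq ⟨hqs, h⟩, unitInterval.le_one'⟩)
  have hsub : S'ᶜ ⊆ V := by
    refine (h.isPreconnected_compl_of_lt hC hCo (hrst.1.trans hrst.2)).subset_of_closure_inter_subset
      hVo ⟨z, compl_subset_compl.2 hS'S hz, mem_connectedComponentIn hz⟩ ?_
    rintro w ⟨hw, hwS⟩
    by_contra hwV
    exact hwS (hfr (by rw [hVo.frontier_eq]; exact ⟨hw, hwV⟩))
  have hVeq : (C ∪ range β)ᶜ = V := ((compl_subset_compl.2 hS'S).trans hsub).antisymm hVS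
  refine h.not_isPreconnected_compl hC hCc ?_
  rw [hVeq]
  exact isPreconnected_connectedComponentIn

/-- The complement of `C ∪ range β` has at most two components. -/
theorem connectedComponentIn_eq_or (h : IsArcAttachedTo β C) (hC : IsCompact C)
    (hCo : IsPreconnected Cᶜ) {p q r : ℂ} (hp : p ∈ (C ∪ range β)ᶜ) (hq : q ∈ (C ∪ range β)ᶜ)
    (hr : r ∈ (C ∪ range β)ᶜ) :
    connectedComponentIn (C ∪ range β)ᶜ p = connectedComponentIn (C ∪ range β)ᶜ q ∨
    connectedComponentIn (C ∪ range β)ᶜ p = connectedComponentIn (C ∪ range β)ᶜ r ∨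
    connectedComponentIn (C ∪ range β)ᶜ q = connectedComponentIn (C ∪ range β)ᶜ r := by
  have hβc : IsCompact (range β) := isCompact_range h.continuous
  have hScpt : IsCompact (C ∪ range β) := hC.union hβc
  have ha : β 0 ∈ C ∩ range β := ⟨h.zero_mem, mem_range_self 0⟩
  have hb : β 1 ∈ C ∩ range β := ⟨h.one_mem, mem_range_self 1⟩
  by_contra! hc
  obtain ⟨hpq, hpr, hqr⟩ := hc
  wlog hbd : Bornology.IsBounded (connectedComponentIn (C ∪ range β)ᶜ q) generalizing q r
  · exact this hr hq hpr hpq hqr.symm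
      ((hScpt.isBounded_connectedComponentIn_compl hqr).resolve_left hbd)
  have hsub : (C ∪ range β)ᶜ ⊆ Cᶜ := compl_subset_compl.2 subset_union_left
  have hne : ∀ w ∈ (C ∪ range β)ᶜ, ∀ z ∈ C ∪ range β, z - w ≠ 0 := fun w hw z hz h =>
    hw (by rwa [← sub_eq_zero.1 h])
  have hlogβ : ∀ w ∈ (C ∪ range β)ᶜ, HasLogOn (fun z => (z - p) / (z - w)) (range β) := by
    intro w hw
    have hI : range β = β '' Icc 0 1 := by
      rw [← image_univ]; congr; ext t; simp [unitInterval.le_one']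
    rw [hI]
    refine hasLogOn_image_Icc h.continuous h.injective zero_le_one
      (ContinuousOn.div (by fun_prop) (by fun_prop) ?_) ?_ <;> rw [← hI]
    · exact fun z hz => hne w hw z (Or.inr hz)
    · exact fun z hz => div_ne_zero (hne p hp z (Or.inr hz)) (hne w hw z (Or.inr hz))
  have hlogC : ∀ w ∈ (C ∪ range β)ᶜ, HasLogOn (fun z => (z - p) / (z - w)) C := fun w hw =>
    hCo.hasLogOn_div hC.isClosed Subset.rfl (hsub hp) (hsub hw)
  obtain ⟨g₁, k₁, n₁, hg₁, hk₁, hgf₁, hkf₁, ha₁, hb₁⟩ :=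
    exists_log_defect (hlogC q hq) (hlogβ q hq) ha hb
  obtain ⟨g₂, k₂, n₂, hg₂, hk₂, hgf₂, hkf₂, ha₂, hb₂⟩ :=
    exists_log_defect (hlogC r hr) (hlogβ r hr) ha hb
  have hn₂ : n₂ ≠ 0 := by
    rintro rfl
    refine hpr (HasLogOn.connectedComponentIn_eq hScpt hp hr
      (.glue hC.isClosed hβc.isClosed hg₂ hk₂ hgf₂ hkf₂ ?_))
    rw [h.inter_range]
    rintro z (rfl | rfl)
    · exact ha₂
    · simpa using hb₂
  have hlog : HasLogOn (fun z => ((z - p) / (z - q)) ^ n₂ * (((z - p) / (z - r)) ^ n₁)⁻¹)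
      (C ∪ range β) := by
    refine .glue (g₁ := fun z => n₂ * g₁ z - n₁ * g₂ z) (g₂ := fun z => n₂ * k₁ z - n₁ * k₂ z)
      hC.isClosed hβc.isClosed (by fun_prop) (by fun_prop) ?_ ?_ ?_
    · intro z hz
      rw [Complex.exp_sub, Complex.exp_int_mul, Complex.exp_int_mul, hgf₁ z hz, hgf₂ z hz,
        div_eq_mul_inv]
    · intro z hz
      rw [Complex.exp_sub, Complex.exp_int_mul, Complex.exp_int_mul, hkf₁ z hz, hkf₂ z hz,
        div_eq_mul_inv]
    · rw [h.inter_range]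
      rintro z (rfl | rfl)
      · simp only [ha₁, ha₂]
      · simp only [hb₁, hb₂]; ring
  have hfar : ∀ w ∈ (C ∪ range β)ᶜ, connectedComponentIn (C ∪ range β)ᶜ q ≠
      connectedComponentIn (C ∪ range β)ᶜ w →
      ∀ z ∈ closure (connectedComponentIn (C ∪ range β)ᶜ q), z - w ≠ 0 := by
    intro w hw hqw z hz hzw
    rw [sub_eq_zero.1 hzw] at hz
    exact hqw (connectedComponentIn_eq_of_mem_closure hScpt.isClosed hw hz)
  refine not_hasLogOn_zpow_mul hScpt.isClosed.isOpen_compl.connectedComponentIn hbd hScpt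
    (hScpt.isClosed.frontier_connectedComponentIn_compl_subset q) (mem_connectedComponentIn hq)
    (u := fun z => (z - p) ^ n₂ * (((z - p) / (z - r)) ^ n₁)⁻¹) ?_ ?_ (neg_ne_zero.2 hn₂)
    (hlog.congr fun z hz => ?_)
  · have hp' := hfar p hp hpq.symm
    have hr' := hfar r hr hqr
    refine ContinuousOn.mul (ContinuousOn.zpow₀ (by fun_prop) _ fun z hz => Or.inl (hp' z hz))
      (ContinuousOn.inv₀ (ContinuousOn.zpow₀ (ContinuousOn.div (by fun_prop) (by fun_prop) hr') _
        fun z hz => Or.inl (div_ne_zero (hp' z hz) (hr' z hz)))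
        fun z hz => zpow_ne_zero _ (div_ne_zero (hp' z hz) (hr' z hz)))
  · intro z hz
    have hp' := hfar p hp hpq.symm z hz
    have hr' := hfar r hr hqr z hz
    exact mul_ne_zero (zpow_ne_zero _ hp')
      (inv_ne_zero (zpow_ne_zero _ (div_ne_zero hp' hr')))
  · simp only
    rw [div_zpow, zpow_neg]
    ring

end IsArcAttachedTo

/-- A plane continuum `C` which does not separate the plane, together with an arc attached to it,
separates the plane into two components having the open arc on their common frontier. -/
theorem IsArcAttachedTo.exists_components {β : unitInterval → Plane} {C : Set Plane}
    (h : IsArcAttachedTo β C) (hC : IsCompact C) (hCc : IsPreconnected C)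
    (hCo : IsPreconnected Cᶜ) :
    ¬ IsPreconnected (C ∪ range β)ᶜ ∧
    (∀ p ∈ (C ∪ range β)ᶜ, ∀ q ∈ (C ∪ range β)ᶜ, ∀ r ∈ (C ∪ range β)ᶜ,
      connectedComponentIn (C ∪ range β)ᶜ p = connectedComponentIn (C ∪ range β)ᶜ q ∨
      connectedComponentIn (C ∪ range β)ᶜ p = connectedComponentIn (C ∪ range β)ᶜ r ∨
      connectedComponentIn (C ∪ range β)ᶜ q = connectedComponentIn (C ∪ range β)ᶜ r) ∧
    ∀ z ∈ (C ∪ range β)ᶜ, ∀ t, t ≠ 0 → t ≠ 1 →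
      β t ∈ frontier (connectedComponentIn (C ∪ range β)ᶜ z) := by
  let e : Plane ≃ₜ ℂ := Complex.orthonormalBasisOneI.repr.symm.toHomeomorph
  have hmem : ∀ {s : Set Plane} {z}, e z ∈ e '' s ↔ z ∈ s := e.injective.mem_set_image
  have h' : IsArcAttachedTo (e ∘ β) (e '' C) :=
    ⟨e.continuous.comp h.continuous, e.injective.comp h.injective, hmem.2 h.zero_mem,
      hmem.2 h.one_mem, fun t h0 h1 ht => h.notMem t h0 h1 (hmem.1 ht)⟩
  have hC' := hC.image e.continuous
  have hCc' := hCc.image e e.continuous.continuousOn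
  have hCo' : IsPreconnected (e '' C)ᶜ := by
    rw [← image_compl_eq e.bijective]
    exact hCo.image e e.continuous.continuousOn
  have hS : (e '' C ∪ range (e ∘ β))ᶜ = e '' (C ∪ range β)ᶜ := by
    rw [image_compl_eq e.bijective, image_union, range_comp]
  have hcomp : ∀ z ∈ (C ∪ range β)ᶜ, connectedComponentIn (e '' C ∪ range (e ∘ β))ᶜ (e z) =
      e '' connectedComponentIn (C ∪ range β)ᶜ z := fun z hz => by
    rw [hS, e.image_connectedComponentIn hz]
  have hmS : ∀ z ∈ (C ∪ range β)ᶜ, e z ∈ (e '' C ∪ range (e ∘ β))ᶜ := fun z hz => by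
    rw [hS]; exact mem_image_of_mem _ hz
  refine ⟨fun hp => h'.not_isPreconnected_compl hC' hCc' ?_, fun p hp q hq r hr => ?_,
    fun z hz t h0 h1 => ?_⟩
  · rw [hS]
    exact hp.image e e.continuous.continuousOn
  · have := h'.connectedComponentIn_eq_or hC' hCo' (hmS p hp) (hmS q hq) (hmS r hr)
    rwa [hcomp p hp, hcomp q hq, hcomp r hr, e.injective.image_injective.eq_iff,
      e.injective.image_injective.eq_iff, e.injective.image_injective.eq_iff] at this
  · have := h'.mem_frontier_connectedComponentIn hC' hCc' hCo' (hmS z hz) h0 h1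
    rwa [hcomp z hz, ← e.image_frontier, Function.comp_apply, hmem] at this

/-- If two connected sets have the complement of `K` as their union and `K` in both their closures,
then no proper subset of `K` separates the space. -/
theorem isPreconnected_compl_of_ssubset {α : Type*} [TopologicalSpace α] {K C W₁ W₂ : Set α}
    (h₁ : IsPreconnected W₁) (h₂ : IsPreconnected W₂) (hK : Kᶜ = W₁ ∪ W₂) (hK₁ : K ⊆ closure W₁)
    (hK₂ : K ⊆ closure W₂) (hC : C ⊂ K) : IsPreconnected Cᶜ := by
  obtain ⟨z, hzK, hzC⟩ := exists_of_ssubset hC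
  have key : ∀ W, IsPreconnected W → K ⊆ closure W → IsPreconnected (W ∪ K \ C) :=
    fun W hW hKW => hW.subset_closure subset_union_left
      (union_subset subset_closure (sdiff_subset.trans hKW))
  have : Cᶜ = (W₁ ∪ K \ C) ∪ (W₂ ∪ K \ C) := by
    rw [← union_union_distrib_right, ← hK]
    ext w
    have hw : w ∈ C → w ∈ K := fun h => hC.subset h
    simp only [mem_compl_iff, mem_union, mem_sdiff]
    tauto
  rw [this]
  exact (key W₁ h₁ hK₁).union z (Or.inr ⟨hzK, hzC⟩) (Or.inr ⟨hzK, hzC⟩) (key W₂ h₂ hK₂)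

theorem IsCompact.connectedComponentIn {α : Type*} [TopologicalSpace α] [T2Space α] {F : Set α}
    (hF : IsCompact F) (x : α) : IsCompact (connectedComponentIn F x) := by
  by_cases hx : x ∈ F
  · refine hF.of_isClosed_subset (closure_subset_iff_isClosed.1 ?_)
      (connectedComponentIn_subset F x)
    exact isPreconnected_connectedComponentIn.closure.subset_connectedComponentIn
      (subset_closure (mem_connectedComponentIn hx))
      (hF.isClosed.closure_subset_iff.2 (connectedComponentIn_subset F x))
  · rw [connectedComponentIn_eq_empty hx]
    exact isCompact_empty

/-- **Step 3 of the proof of Theorem 2.1.** Let `K` be a simple set, `x ∈ K`, `ε > 0` with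
`K \ closure B(x,ε) ≠ ∅`, and let `β₀` be a cross-cut of `W₁` whose distinct end-points
lie in `K(closure B(x,ε), x)`. Then `S = K(closure B(x,ε), x) ∪ β₀(I)` is connected, its
complement has exactly two connected components `V₁`, `V₂`, the open arc `β₀((0,1))` lies
in `frontier V₁ ∩ frontier V₂`, and (with suitable labeling) `V₁ ⊆ W₁` and `W₂ ⊆ V₂`. -/
theorem crossCut_union_component_separates (K W₁ W₂ : Set Plane)
    (h : IsSimpleSet K W₁ W₂) (x : Plane) (hx : x ∈ K) (ε : ℝ) (hε : 0 < ε)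
    (hKout : (K \ closedBall x ε).Nonempty)
    (β₀ : unitInterval → Plane) (hβ₀ : IsCrossCut W₁ β₀) (hne : β₀ 0 ≠ β₀ 1)
    (h0 : β₀ 0 ∈ connectedComponentIn (K ∩ closedBall x ε) x)
    (h1 : β₀ 1 ∈ connectedComponentIn (K ∩ closedBall x ε) x)
    (S : Set Plane)
    (hS : S = connectedComponentIn (K ∩ closedBall x ε) x ∪ Set.range β₀) :
    IsConnected S ∧
    ∃ V₁ V₂ : Set Plane,
      V₁ ≠ V₂ ∧
      (∃ z ∈ Sᶜ, connectedComponentIn Sᶜ z = V₁) ∧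
      (∃ z ∈ Sᶜ, connectedComponentIn Sᶜ z = V₂) ∧
      (∀ z ∈ Sᶜ, connectedComponentIn Sᶜ z = V₁ ∨ connectedComponentIn Sᶜ z = V₂) ∧
      β₀ '' {t : unitInterval | t ≠ 0 ∧ t ≠ 1} ⊆ frontier V₁ ∩ frontier V₂ ∧
      V₁ ⊆ W₁ ∧ W₂ ⊆ V₂ := by
  obtain ⟨⟨hK, hW, ⟨w₁, hw₁, rfl⟩, ⟨w₂, hw₂, rfl⟩, hall⟩, hA₁, hA₂⟩ := h
  subst hS
  set W₁ := connectedComponentIn Kᶜ w₁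
  set W₂ := connectedComponentIn Kᶜ w₂
  set C := connectedComponentIn (K ∩ closedBall x ε) x
  have hKcl : ∀ W, K ⊆ closure (AccPts K W) → K ⊆ closure W := fun W hA =>
    hA.trans (closure_minimal (fun z hz => hz.2.1.1) isClosed_closure)
  have hK₂ : K ⊆ closure W₂ := hKcl _ hA₂
  have hCsub : C ⊆ K ∩ closedBall x ε := connectedComponentIn_subset _ _
  have hC : IsCompact C := (hK.inter_right isClosed_closedBall).connectedComponentIn x
  have hCK : C ⊂ K := by
    obtain ⟨z, hzK, hz⟩ := hKout
    exact (ssubset_iff_of_subset (hCsub.trans inter_subset_left)).2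
      ⟨z, hzK, fun h => hz (hCsub h).2⟩
  have hunion : Kᶜ = W₁ ∪ W₂ := by
    refine Subset.antisymm (fun z hz => ?_)
      (union_subset (connectedComponentIn_subset _ _) (connectedComponentIn_subset _ _))
    have hzz := mem_connectedComponentIn hz
    rcases hall z hz with h | h <;> rw [h] at hzz
    exacts [Or.inl hzz, Or.inr hzz]
  have hCo : IsPreconnected Cᶜ :=
    isPreconnected_compl_of_ssubset isPreconnected_connectedComponentIn
      isPreconnected_connectedComponentIn hunion (hKcl _ hA₁) hK₂ hCK
  have hβ : IsArcAttachedTo β₀ C :=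
    ⟨hβ₀.1, hβ₀.2.1, h0, h1, fun t ht0 ht1 ht =>
      connectedComponentIn_subset _ _ (hβ₀.2.2.2.2 t ht0 ht1) (hCK.subset ht)⟩
  obtain ⟨hsep, htwo, hfr⟩ := hβ.exists_components hC isPreconnected_connectedComponentIn hCo
  set S := C ∪ range β₀
  have hSc : IsClosed S := (hC.union (isCompact_range hβ₀.1)).isClosed
  have hdisj : Disjoint W₁ W₂ := by
    refine disjoint_left.2 fun z hz₁ hz₂ => hW ?_
    exact (connectedComponentIn_eq hz₁).trans (connectedComponentIn_eq hz₂).symm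
  have hW₂S : W₂ ⊆ Sᶜ := by
    rintro z hz (hzC | ⟨t, rfl⟩)
    · exact connectedComponentIn_subset _ _ hz (hCK.subset hzC)
    · by_cases ht0 : t = 0
      · exact connectedComponentIn_subset _ _ hz (hCK.subset (ht0 ▸ h0))
      by_cases ht1 : t = 1
      · exact connectedComponentIn_subset _ _ hz (hCK.subset (ht1 ▸ h1))
      exact disjoint_left.1 hdisj (hβ₀.2.2.2.2 t ht0 ht1) hz
  have hw₂W : w₂ ∈ W₂ := mem_connectedComponentIn hw₂
  have hw₂S := hW₂S hw₂W
  obtain ⟨z, hz, hzw⟩ : ∃ z ∈ Sᶜ, connectedComponentIn Sᶜ z ≠ connectedComponentIn Sᶜ w₂ := by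
    by_contra! hcon
    refine hsep ?_
    have : Sᶜ = connectedComponentIn Sᶜ w₂ := Subset.antisymm
      (fun z hz => hcon z hz ▸ mem_connectedComponentIn hz) (connectedComponentIn_subset _ _)
    rw [this]
    exact isPreconnected_connectedComponentIn
  have hW₂V : W₂ ⊆ connectedComponentIn Sᶜ w₂ :=
    isPreconnected_connectedComponentIn.subset_connectedComponentIn hw₂W hW₂S
  refine ⟨IsConnected.union ⟨β₀ 0, h0, mem_range_self 0⟩ ⟨⟨_, h0⟩,
    isPreconnected_connectedComponentIn⟩ (isConnected_range hβ₀.1),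
    connectedComponentIn Sᶜ z, connectedComponentIn Sᶜ w₂, hzw, ⟨z, hz, rfl⟩, ⟨w₂, hw₂S, rfl⟩,
    fun y hy => ?_, ?_, ?_, hW₂V⟩
  · rcases htwo y hy z hz w₂ hw₂S with h | h | h
    exacts [Or.inl h, Or.inr h, absurd h hzw]
  · rintro _ ⟨t, ⟨ht0, ht1⟩, rfl⟩
    exact ⟨hfr z hz t ht0 ht1, hfr w₂ hw₂S t ht0 ht1⟩
  · have hd : Disjoint (connectedComponentIn Sᶜ z) (connectedComponentIn Sᶜ w₂) :=
      disjoint_left.2 fun y hy₁ hy₂ =>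
        hzw ((connectedComponentIn_eq hy₁).trans (connectedComponentIn_eq hy₂).symm)
    have hd₂ : Disjoint (connectedComponentIn Sᶜ z) (closure W₂) :=
      (hd.mono_right hW₂V).closure_right hSc.isOpen_compl.connectedComponentIn
    intro y hy
    have hyK : y ∈ Kᶜ := fun h => disjoint_left.1 hd₂ hy (hK₂ h)
    rw [hunion] at hyK
    exact hyK.resolve_right fun h => disjoint_left.1 hd₂ hy (subset_closure h)
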